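/- arXiv:1804.01317 — 2 statements merged into one kernel-verified Lean document; each statement's English description precedes it below -/
import Mathlib

section
/- If G is a graph with n vertices and ⌊n/2⌋⌈n/2⌉ + s edges, where 0 ≤ s < ⌊n/2⌋, then G contains at least s⌊n/2⌋ triangles. -/
open Finset

theorem Int.mul_pred_nonneg (n : ℤ) : 0 ≤ n * (n - 1) := by
  rcases le_or_gt n 0 with h | h
  · exact mul_nonneg_of_nonpos_of_nonpos h (by linarith)
  · exact mul_nonneg h.le (by linarith)

/-- The missing edges of a cut of sizes `k + j + σ`, `k - j` with `p` inside edges and `q` missing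
edges destroy few triangles: `S` is the number of incident pairs of an inside and a missing edge,
and `Dx, Dy` (`mx, my`) are the inside (missing) degrees of the ends of a missing edge. -/
theorem incidence_le (k j σ s p q PA PB Dx Dy mx my S : ℤ) (hσ : σ = 0 ∨ σ = 1) (hj : 0 ≤ j)
    (hs : s ≤ k - 1) (hp : p = s + q + j ^ 2 + σ * j) (hP : PA + PB = 2 * p)
    (hpk : p ≤ 2 * k - 4) (hx : Dx + mx ≤ k - j) (hy : Dy + my ≤ k + j + σ)
    (hmx : 1 ≤ mx) (hmy : 1 ≤ my) (hq : mx + my - 1 ≤ q) (hPA : 2 * Dx ≤ PA) (hPB : 2 * Dy ≤ PB)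
    (hDx : 0 ≤ Dx) (hDy : 0 ≤ Dy) (hS : S ≤ q * (Dx + Dy))
    (hmain : 2 * S ≤ 2 * mx * Dx + 2 * my * Dy + 2 * p + mx * (mx - 1) + my * (my - 1)
      - 2 * (Dx + Dy) + (q - mx - my + 1) * (2 * p + 4 - 2 * (Dx + Dy))) :
    2 * S ≤ 2 * (q + j ^ 2 + σ * j) * k - j * PA + (j + σ) * PB := by
  obtain ⟨u, rfl⟩ : ∃ u, mx = u + 1 := ⟨mx - 1, by ring⟩
  obtain ⟨v, rfl⟩ : ∃ v, my = v + 1 := ⟨my - 1, by ring⟩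
  obtain ⟨z, rfl⟩ : ∃ z, q = u + v + 1 + z := ⟨q - u - v - 1, by ring⟩
  obtain ⟨c, hc⟩ : ∃ c, Dx + Dy = k + c := ⟨Dx + Dy - k, by ring⟩
  obtain rfl : PA = 2 * p - PB := by linarith
  have hu : 0 ≤ u := by linarith
  have hv : 0 ≤ v := by linarith
  have hz : 0 ≤ z := by linarith
  have hE : c ≤ -1 ∨ 2 * S ≤ 2 * (u + v + 1 + z) * k + 2 * c + 2 * u * (- j - 1 - u)
      + 2 * v * (Dy - k) + u * (u + 1) + v * (v + 1) + 2 * (p - k - c) - 4 * z := by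
    by_cases h : c ≤ -1
    · exact Or.inl h
    right
    have h1 : u * Dx ≤ u * (k - j - 1 - u) := mul_le_mul_of_nonneg_left (by linarith) hu
    have h2 : z * (2 * p + 4 - 2 * (Dx + Dy)) ≤ z * (2 * k - 4) :=
      mul_le_mul_of_nonneg_left (by linarith) hz
    have h3 : Dx = k + c - Dy := by linarith
    subst h3
    nlinarith
  have hyv : v * (Dy - k) ≤ v * (j + σ - 1 - v) :=
    mul_le_mul_of_nonneg_left (by linarith) hv
  have hDy' : c + j + 1 + u ≤ Dy := by linarith
  have hr : p - k - c ≤ u + v + z + j ^ 2 + σ * j - c := by linarith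
  have hS' : S ≤ (u + v + 1 + z) * (k + c) := hc ▸ hS
  have hc0 : c ≤ 0 → S ≤ (u + v + 1 + z) * k := fun h =>
    hS'.trans (mul_le_mul_of_nonneg_left (by linarith) (by linarith))
  clear hmain hS
  have hu2 := Int.mul_pred_nonneg u
  have hv2 := Int.mul_pred_nonneg v
  rcases hσ with rfl | rfl
  · obtain rfl | rfl | hj2 : j = 0 ∨ j = 1 ∨ 2 ≤ j := by omega
    · rcases le_or_gt c 0 with h | h
      · linarith [hc0 h]
      · rcases hE with h' | h'
        · omega
        · linarith
    · rcases le_or_gt c (-1) with h | h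
      · have := hS'.trans (mul_le_mul_of_nonneg_left (show k + c ≤ k - 1 by linarith)
          (show 0 ≤ u + v + 1 + z by linarith))
        linarith
      · rcases hE with h' | h'
        · omega
        · rcases eq_or_lt_of_le (show 0 ≤ c by omega) with h0 | h0
          · subst h0
            have := hc0 le_rfl
            rcases le_or_gt (p - PB) k with hw | hw
            · linarith
            · rcases le_or_gt v 3 with h3 | h3
              · have h4 : v * (Dy - k) ≤ v * (-4) := mul_le_mul_of_nonneg_left (by omega) hv
                have h5 : 0 ≤ (4 - v) * (v + 1) := mul_nonneg (by linarith) (by linarith)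
                linarith
              · have h5 : 0 ≤ (v - 4) * (v - 1) := mul_nonneg (by linarith) (by linarith)
                linarith
          · linarith [Int.mul_pred_nonneg (v - 2)]
    · have hk : 0 ≤ j * (j - 2) * k :=
        mul_nonneg (mul_nonneg hj (by linarith)) (by linarith)
      have hjp : j * p ≤ j * (2 * k - 4) := mul_le_mul_of_nonneg_left hpk hj
      have hjB : j * (2 * Dy) ≤ j * PB := mul_le_mul_of_nonneg_left hPB hj
      have hjD : j * (c + j + 1 + u) ≤ j * Dy := mul_le_mul_of_nonneg_left hDy' hj
      rcases le_or_gt c 0 with h | h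
      · linarith [hc0 h, mul_nonneg hj hDy]
      · rcases hE with h' | h'
        · omega
        · linarith [sq_nonneg (2 * v - 2 * j - 1), mul_nonneg hj hu, mul_nonneg hj h.le,
            sq_nonneg j]
  · have hk : 0 ≤ j * (j - 1) * k :=
      mul_nonneg (Int.mul_pred_nonneg j) (by linarith)
    have hjp : j * p ≤ j * (2 * k - 4) := mul_le_mul_of_nonneg_left hpk hj
    have hjB : j * (2 * Dy) ≤ j * PB := mul_le_mul_of_nonneg_left hPB hj
    have hjD : j * (c + j + 1 + u) ≤ j * Dy := mul_le_mul_of_nonneg_left hDy' hj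
    rcases le_or_gt c 0 with h | h
    · linarith [hc0 h, mul_nonneg hj hDy]
    · rcases hE with h' | h'
      · omega
      · rcases eq_or_lt_of_le hj with rfl | hj1
        · linarith [Int.mul_pred_nonneg (v - 1)]
        · linarith [sq_nonneg (2 * v - 2 * j - 3), mul_nonneg hj hu, mul_nonneg hj h.le,
            sq_nonneg j]

theorem two_mul_sum_sum_le {V : Type*} [DecidableEq V] (g : V → V → ℤ)
    (h0 : ∀ x y, 0 ≤ g x y) (h1 : ∀ x y, g x y ≤ 1)
    (hs : ∀ x y, g x y = g y x) (hd : ∀ x, g x x = 0) {X A : Finset V} (hX : X ⊆ A) :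
    2 * ∑ x ∈ X, ∑ v ∈ A, g x v ≤ ∑ u ∈ A, ∑ v ∈ A, g u v + #X * (#X - 1) := by
  have hsplit : ∀ F : V → ℤ, ∑ v ∈ A, F v = ∑ v ∈ A \ X, F v + ∑ v ∈ X, F v :=
    fun F => (sum_sdiff hX).symm
  have hYX : ∑ u ∈ A \ X, ∑ v ∈ X, g u v = ∑ u ∈ X, ∑ v ∈ A \ X, g u v := by
    rw [sum_comm]; simp only [hs]
  have hYY : 0 ≤ ∑ u ∈ A \ X, ∑ v ∈ A \ X, g u v :=
    sum_nonneg fun _ _ => sum_nonneg fun _ _ => h0 _ _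
  have hXX : ∑ u ∈ X, ∑ v ∈ X, g u v ≤ #X * (#X - 1) := by
    rw [← nsmul_eq_mul]
    refine sum_le_card_nsmul _ _ _ fun u hu => ?_
    rw [← sum_erase_add _ _ hu, hd, add_zero]
    refine (sum_le_card_nsmul _ _ 1 fun v _ => h1 u v).trans ?_
    rw [card_erase_of_mem hu, nsmul_one, Nat.cast_sub (card_pos.2 ⟨u, hu⟩), Nat.cast_one]
  simp only [hsplit, sum_add_distrib] at *
  linarith

theorem sum_sum_eq_cross {V : Type*} [DecidableEq V] {A B : Finset V} {x y : V}
    (hx : x ∈ A) (hy : y ∈ B) (F : V → V → ℤ) :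
    ∑ u ∈ A, ∑ w ∈ B, F u w = ∑ w ∈ B, F x w + ∑ u ∈ A, F u y - F x y
      + ∑ u ∈ A.erase x, ∑ w ∈ B.erase y, F u w := by
  rw [← add_sum_erase A _ hx, ← add_sum_erase A (fun u => F u y) hx,
    sum_congr rfl fun u _ => (add_sum_erase B (F u) hy).symm, sum_add_distrib]
  ring

theorem sum_mul_eq_sum_filter {V : Type*} (B : Finset V) (f d : V → ℤ)
    (hf : ∀ w, f w = 0 ∨ f w = 1) :
    ∑ w ∈ B, f w * d w = ∑ w ∈ B with f w = 1, d w := by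
  rw [sum_filter]
  refine sum_congr rfl fun w _ => ?_
  rcases hf w with h | h <;> simp [h]

theorem sum_mul_le_of_subset_bound {V : Type*} (B : Finset V) (f d : V → ℤ) (P : ℤ)
    (hf : ∀ w, f w = 0 ∨ f w = 1) (hB : ∀ X ⊆ B, 2 * ∑ x ∈ X, d x ≤ P + #X * (#X - 1)) :
    2 * ∑ w ∈ B, f w * d w ≤ P + (∑ w ∈ B, f w) * (∑ w ∈ B, f w - 1) := by
  have h1 := sum_mul_eq_sum_filter B f d hf
  have h2 := sum_mul_eq_sum_filter B f 1 hf
  simp only [Pi.one_apply, mul_one, sum_const, nsmul_eq_mul] at h2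
  rw [h1, h2]
  exact hB _ (filter_subset _ _)

/-- Incidences between inside and missing edges, counted from a fixed missing edge `xy`. -/
theorem sum_cross_le {V : Type*} [DecidableEq V] (A B : Finset V) (f : V → V → ℤ)
    (d : V → ℤ) (PA PB : ℤ)
    (hf : ∀ x y, f x y = 0 ∨ f x y = 1)
    (hA : ∀ X ⊆ A, 2 * ∑ x ∈ X, d x ≤ PA + #X * (#X - 1))
    (hB : ∀ X ⊆ B, 2 * ∑ x ∈ X, d x ≤ PB + #X * (#X - 1))
    {x y : V} (hx : x ∈ A) (hy : y ∈ B) (hxy : f x y = 1) {q mx my : ℤ}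
    (hq : q = ∑ u ∈ A, ∑ w ∈ B, f u w) (hmx : mx = ∑ w ∈ B, f x w) (hmy : my = ∑ u ∈ A, f u y) :
    mx + my - 1 ≤ q ∧
    2 * ∑ u ∈ A, ∑ w ∈ B, f u w * (d u + d w) ≤ 2 * mx * d x + 2 * my * d y + (PA + PB)
      + mx * (mx - 1) + my * (my - 1) - 2 * (d x + d y)
      + (q - mx - my + 1) * (PA + PB + 4 - 2 * (d x + d y)) := by
  have hf0 : ∀ x y, 0 ≤ f x y := fun x y => by rcases hf x y with h | h <;> simp [h]
  have hz := sum_sum_eq_cross hx hy f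
  rw [← hq, ← hmx, ← hmy, hxy] at hz
  have hz0 : 0 ≤ ∑ u ∈ A.erase x, ∑ w ∈ B.erase y, f u w :=
    sum_nonneg fun _ _ => sum_nonneg fun _ _ => hf0 _ _
  refine ⟨by linarith, ?_⟩
  have pair : ∀ (C : Finset V) (P : ℤ), (∀ X ⊆ C, 2 * ∑ x ∈ X, d x ≤ P + #X * (#X - 1)) →
      ∀ a ∈ C, ∀ b ∈ C.erase a, 2 * d b ≤ P + 2 - 2 * d a := by
    intro C P hC a ha b hb
    have hab : a ≠ b := (ne_of_mem_erase hb).symm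
    have := hC {a, b} (by simp [insert_subset_iff, ha, mem_of_mem_erase hb])
    rw [sum_pair hab, card_pair hab] at this
    push_cast at this
    linarith
  have hrest : 2 * ∑ u ∈ A.erase x, ∑ w ∈ B.erase y, f u w * (d u + d w) ≤
      (∑ u ∈ A.erase x, ∑ w ∈ B.erase y, f u w) * (PA + PB + 4 - 2 * (d x + d y)) := by
    simp only [mul_sum, sum_mul]
    refine sum_le_sum fun u hu => sum_le_sum fun w hw => ?_
    rw [mul_left_comm]
    refine mul_le_mul_of_nonneg_left ?_ (hf0 u w)
    linarith [pair A PA hA x hx u hu, pair B PB hB y hy w hw]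
  have hX := sum_mul_le_of_subset_bound B (f x) d PB (hf x) hB
  have hY := sum_mul_le_of_subset_bound A (fun u => f u y) d PA (fun u => hf u y) hA
  simp only [← hmx, ← hmy] at hX hY
  rw [sum_sum_eq_cross hx hy]
  have e1 : ∑ w ∈ B, f x w * (d x + d w) = mx * d x + ∑ w ∈ B, f x w * d w := by
    simp only [mul_add, sum_add_distrib, hmx, sum_mul]
  have e2 : ∑ u ∈ A, f u y * (d u + d y) = my * d y + ∑ u ∈ A, f u y * d u := by
    simp only [mul_add, sum_add_distrib, hmy, sum_mul]; ring
  rw [e1, e2, hxy]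
  rw [show ∑ u ∈ A.erase x, ∑ w ∈ B.erase y, f u w = q - mx - my + 1 by linarith] at hrest
  linarith


theorem sum_sum_insert {V : Type*} [DecidableEq V] (g : V → V → ℤ)
    (hs : ∀ x y, g x y = g y x) (hd : ∀ x, g x x = 0) {x : V} {C : Finset V} (hx : x ∉ C) :
    ∑ u ∈ insert x C, ∑ v ∈ insert x C, g u v
      = ∑ u ∈ C, ∑ v ∈ C, g u v + 2 * ∑ v ∈ C, g x v := by
  simp only [sum_insert hx, sum_add_distrib, hd, hs _ x]
  ring

theorem cross_triangles_le {V : Type*} (g : V → V → ℤ) (hg : ∀ x y, g x y = 0 ∨ g x y = 1)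
    (hs : ∀ x y, g x y = g y x) (A B : Finset V) :
    #B * ∑ u ∈ A, ∑ v ∈ A, g u v - 2 * ∑ u ∈ A, ∑ w ∈ B, (1 - g u w) * ∑ v ∈ A, g u v ≤
      ∑ u ∈ A, ∑ v ∈ A, ∑ w ∈ B, g u v * g v w * g u w := by
  have key : ∑ u ∈ A, ∑ v ∈ A, ∑ w ∈ B, (g u v - (1 - g u w) * g u v - (1 - g v w) * g v u) ≤
      ∑ u ∈ A, ∑ v ∈ A, ∑ w ∈ B, g u v * g v w * g u w := by
    refine sum_le_sum fun u _ => sum_le_sum fun v _ => sum_le_sum fun w _ => ?_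
    rw [hs v u]
    rcases hg u v with h1 | h1 <;> rcases hg u w with h2 | h2 <;> rcases hg v w with h3 | h3 <;>
      simp [h1, h2, h3]
  refine le_trans (le_of_eq ?_) key
  simp only [sum_sub_distrib, mul_sum, sum_const, nsmul_eq_mul]
  have e1 : ∑ u ∈ A, ∑ v ∈ A, ∑ w ∈ B, (1 - g u w) * g u v
      = ∑ u ∈ A, ∑ w ∈ B, ∑ v ∈ A, (1 - g u w) * g u v :=
    sum_congr rfl fun u _ => sum_comm
  have e2 : ∑ u ∈ A, ∑ v ∈ A, ∑ w ∈ B, (1 - g v w) * g v u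
      = ∑ u ∈ A, ∑ w ∈ B, ∑ v ∈ A, (1 - g u w) * g u v := by
    rw [sum_comm, e1]
  rw [e1, e2]
  simp only [← mul_sum]
  ring

/-- A maximum cut is locally optimal, and has at most as many inside edges as the average of the
cuts given by the neighbourhoods of the vertices. -/
theorem exists_max_cut {V : Type*} [DecidableEq V] [Fintype V] (g : V → V → ℤ)
    (hg : ∀ x y, g x y = 0 ∨ g x y = 1)
    (hs : ∀ x y, g x y = g y x) (hd : ∀ x, g x x = 0) :
    ∃ A : Finset V, #Aᶜ ≤ #A ∧
      (∀ x ∈ A, ∑ v ∈ A, g x v ≤ ∑ v ∈ Aᶜ, g x v) ∧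
      (∀ x ∈ Aᶜ, ∑ v ∈ Aᶜ, g x v ≤ ∑ v ∈ A, g x v) ∧
      Fintype.card V * (∑ u ∈ A, ∑ v ∈ A, g u v + ∑ u ∈ Aᶜ, ∑ v ∈ Aᶜ, g u v) ≤
        2 * ∑ u, ∑ v, ∑ w, g u v * g v w * g u w - 2 * ∑ u, (∑ v, g u v) ^ 2
          + Fintype.card V * ∑ u, ∑ v, g u v := by
  let P : Finset V → ℤ := fun A => ∑ u ∈ A, ∑ v ∈ A, g u v + ∑ u ∈ Aᶜ, ∑ v ∈ Aᶜ, g u v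
  have hPc : ∀ A, P Aᶜ = P A := fun A => by simp only [P, compl_compl]; ring
  obtain ⟨A, hA, hcard⟩ : ∃ A, (∀ C, P A ≤ P C) ∧ #Aᶜ ≤ #A := by
    obtain ⟨A, hA⟩ := Finite.exists_min P
    rcases le_total (#Aᶜ) (#A) with h | h
    · exact ⟨A, hA, h⟩
    · exact ⟨Aᶜ, fun C => hPc A ▸ hA C, by rwa [compl_compl]⟩
  have hloc : ∀ A, (∀ C, P A ≤ P C) → ∀ x ∈ A, ∑ v ∈ A, g x v ≤ ∑ v ∈ Aᶜ, g x v := by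
    intro A hA x hx
    have h := hA (A.erase x)
    have h1 := sum_sum_insert g hs hd (notMem_erase x A)
    have h2 := sum_sum_insert g hs hd (x := x) (C := Aᶜ) (by simpa using hx)
    rw [insert_erase hx] at h1
    simp only [P, compl_erase] at h
    rw [← sum_erase_add _ _ hx, hd]
    linarith
  refine ⟨A, hcard, hloc A hA, fun x hx => ?_, ?_⟩
  · simpa using hloc Aᶜ (fun C => (hPc A).symm ▸ hA C) x hx
  · have hN : ∀ x, P A ≤ ∑ u, ∑ v,
        (2 * (g x u * g u v * g x v) + g u v - g x u * g u v - g x v * g v u) := by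
      intro x
      refine (hA {v | g x v = 1}).trans (le_of_eq ?_)
      simp only [P, compl_filter, sum_filter]
      rw [← sum_add_distrib]
      refine sum_congr rfl fun u _ => ?_
      rw [← sum_filter_add_sum_filter_not univ (fun v => g x v = 1), sum_filter, sum_filter,
        ← sum_add_distrib]
      rcases hg x u with h | h
      · simp only [h]
        simp only [zero_ne_one, if_false, not_false_eq_true, if_true, zero_add]
        refine sum_congr rfl fun v _ => ?_
        rcases hg x v with h' | h' <;> simp [h', hs v u]
      · simp only [h]
        simp only [if_true, not_true_eq_false, if_false, add_zero]
        refine sum_congr rfl fun v _ => ?_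
        rcases hg x v with h' | h'
        · simp [h', hs v u]
        · simp [h', hs v u]; ring
    have hsum := sum_le_sum fun x (_ : x ∈ univ) => hN x
    rw [sum_const, nsmul_eq_mul, card_univ] at hsum
    refine hsum.trans (le_of_eq ?_)
    simp only [sum_add_distrib, sum_sub_distrib, ← mul_sum, sum_const, nsmul_eq_mul, card_univ]
    have e0 : ∑ x, ∑ u, ∑ v, g x u * g u v = ∑ u, (∑ v, g u v) ^ 2 := by
      rw [sum_comm]
      refine sum_congr rfl fun u _ => ?_
      rw [sq, sum_mul_sum]
      simp only [hs u]
    have e1 : ∑ x, ∑ u, g x u * ∑ v, g u v = ∑ u, (∑ v, g u v) ^ 2 := by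
      rw [← e0]; simp only [mul_sum]
    have e2 : ∑ x, ∑ u, ∑ v, g x v * g v u = ∑ u, (∑ v, g u v) ^ 2 := by
      rw [← e0]; exact sum_congr rfl fun x _ => sum_comm
    rw [e2, e1]
    ring

theorem crossing_triangles_le {V : Type*} [DecidableEq V] [Fintype V] (g : V → V → ℤ)
    (hg : ∀ x y, g x y = 0 ∨ g x y = 1)
    (hs : ∀ x y, g x y = g y x) (A : Finset V) :
    3 * (∑ u ∈ A, ∑ v ∈ A, ∑ w ∈ Aᶜ, g u v * g v w * g u w +
      ∑ u ∈ Aᶜ, ∑ v ∈ Aᶜ, ∑ w ∈ A, g u v * g v w * g u w) ≤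
    ∑ u, ∑ v, ∑ w, g u v * g v w * g u w := by
  have h0 : ∀ x y, 0 ≤ g x y := fun x y => by rcases hg x y with h | h <;> simp [h]
  have hpos : ∀ C : Finset V, 0 ≤ ∑ u ∈ C, ∑ v ∈ C, ∑ w ∈ C, g u v * g v w * g u w := fun C =>
    sum_nonneg fun _ _ => sum_nonneg fun _ _ => sum_nonneg fun _ _ =>
      mul_nonneg (mul_nonneg (h0 _ _) (h0 _ _)) (h0 _ _)
  have e1 : ∀ C D : Finset V, ∑ u ∈ C, ∑ v ∈ D, ∑ w ∈ C, g u v * g v w * g u w =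
      ∑ u ∈ C, ∑ v ∈ C, ∑ w ∈ D, g u v * g v w * g u w := fun C D =>
    sum_congr rfl fun u _ => by
      rw [sum_comm]
      refine sum_congr rfl fun v _ => sum_congr rfl fun w _ => ?_
      rw [hs w v]; ring
  have e2 : ∀ C D : Finset V, ∑ u ∈ D, ∑ v ∈ C, ∑ w ∈ C, g u v * g v w * g u w =
      ∑ u ∈ C, ∑ v ∈ C, ∑ w ∈ D, g u v * g v w * g u w := fun C D => by
    rw [← e1, sum_comm]
    refine sum_congr rfl fun v _ => sum_congr rfl fun u _ => sum_congr rfl fun w _ => ?_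
    rw [hs v u]; ring
  simp only [← sum_add_sum_compl A, sum_add_distrib, e1, e2]
  linarith [hpos A, hpos Aᶜ, e1 A Aᶜ, e1 Aᶜ A, e2 A Aᶜ, e2 Aᶜ A]

theorem incidence_le_of_no_missing (k j σ s p PA PB : ℤ) (hσ : σ = 0 ∨ σ = 1)
    (hj : 0 ≤ j) (hk : 0 ≤ k)
    (hs : s ≤ k - 1) (hp : p = s + j ^ 2 + σ * j) (hP : PA + PB = 2 * p)
    (hpk : p ≤ 2 * k - 4) (hPB : 0 ≤ PB) :
    0 ≤ 2 * (j ^ 2 + σ * j) * k - j * PA + (j + σ) * PB := by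
  obtain rfl : PA = 2 * p - PB := by linarith
  have hjp : j * p ≤ j * (2 * k - 4) := mul_le_mul_of_nonneg_left hpk hj
  have hjB := mul_nonneg hj hPB
  rcases hσ with rfl | rfl
  · obtain rfl | rfl | hj2 : j = 0 ∨ j = 1 ∨ 2 ≤ j := by omega
    · linarith
    · linarith
    · linarith [mul_nonneg (mul_nonneg hj (show 0 ≤ j - 2 by linarith)) hk]
  · linarith [mul_nonneg (Int.mul_pred_nonneg j) hk]

theorem lt_ordered_triangles {V : Type*} [DecidableEq V] [Fintype V] (g : V → V → ℤ)
    (hg : ∀ x y, g x y = 0 ∨ g x y = 1)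
    (hs : ∀ x y, g x y = g y x) (hd : ∀ x, g x x = 0) (k s σ : ℤ) (hσ : σ = 0 ∨ σ = 1)
    (hs1 : 1 ≤ s) (hsk : s ≤ k - 1) (hn : (Fintype.card V : ℤ) = 2 * k + σ)
    (he : ∑ u, ∑ v, g u v = 2 * (k * (k + σ) + s)) :
    6 * (s * k - 1) < ∑ u, ∑ v, ∑ w, g u v * g v w * g u w := by
  by_contra! hτ
  have h0 : ∀ x y, 0 ≤ g x y := fun x y => by rcases hg x y with h | h <;> simp [h]
  have h1 : ∀ x y, g x y ≤ 1 := fun x y => by rcases hg x y with h | h <;> simp [h]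
  obtain ⟨A, hcard, hlA, hlB, hcut⟩ := exists_max_cut g hg hs hd
  have hab : (#A : ℤ) + #Aᶜ = 2 * k + σ := by rw [← hn]; exact_mod_cast card_add_card_compl A
  obtain ⟨j, hj⟩ : ∃ j : ℤ, #Aᶜ = k - j := ⟨k - #Aᶜ, by ring⟩
  have ha : (#A : ℤ) = k + j + σ := by linarith
  have hj0 : 0 ≤ j := by
    have : (#Aᶜ : ℤ) ≤ #A := by exact_mod_cast hcard
    omega
  have hsq : (2 * k + 1) * (2 * (k * (k + σ) + s)) - k * (k + 1) * (2 * k + σ) ≤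
      ∑ u, (∑ v, g u v) ^ 2 := by
    have h := sum_nonneg fun u (_ : u ∈ univ) => Int.mul_pred_nonneg (∑ v, g u v - k)
    have h' : ∀ d : ℤ, (d - k) * (d - k - 1) = d ^ 2 - (2 * k + 1) * d + k * (k + 1) :=
      fun d => by ring
    simp only [h', sum_add_distrib, sum_sub_distrib, ← mul_sum, he, sum_const, nsmul_eq_mul,
      card_univ, hn] at h
    linarith
  set PA := ∑ u ∈ A, ∑ v ∈ A, g u v with hPA
  set PB := ∑ u ∈ Aᶜ, ∑ v ∈ Aᶜ, g u v with hPB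
  obtain ⟨q, hq⟩ : ∃ q, q = ∑ u ∈ A, ∑ w ∈ Aᶜ, (1 - g u w) := ⟨_, rfl⟩
  have hcross : ∑ u ∈ A, ∑ w ∈ Aᶜ, g u w = #A * #Aᶜ - q := by
    simp [hq, sum_sub_distrib]
  obtain ⟨p, hp⟩ : ∃ p, p = s + q + j ^ 2 + σ * j := ⟨_, rfl⟩
  have hP : PA + PB = 2 * p := by
    have h := he
    simp only [← sum_add_sum_compl A, sum_add_distrib] at h
    have h' : ∑ u ∈ Aᶜ, ∑ w ∈ A, g u w = ∑ u ∈ A, ∑ w ∈ Aᶜ, g u w := by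
      rw [sum_comm]; simp only [hs]
    rw [h', hcross, ha, hj] at h
    linarith
  have hpk : p ≤ 2 * k - 4 := by
    by_contra! hlt
    rw [hP, hn, he] at hcut
    rcases hσ with rfl | rfl
    · have h2 : k * (2 * k - 3) ≤ k * p := mul_le_mul_of_nonneg_left (by linarith) (by linarith)
      have h3 : s * (4 * k - 2) ≤ (k - 1) * (4 * k - 2) :=
        mul_le_mul_of_nonneg_right hsk (by linarith)
      linarith
    · have h2 : (2 * k + 1) * (2 * k - 3) ≤ (2 * k + 1) * p :=
        mul_le_mul_of_nonneg_left (by linarith) (by linarith)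
      have h3 : s * (4 * k - 1) ≤ (k - 1) * (4 * k - 1) :=
        mul_le_mul_of_nonneg_right hsk (by linarith)
      linarith
  obtain ⟨d, hdA, hdB⟩ : ∃ d : V → ℤ, (∀ u ∈ A, d u = ∑ v ∈ A, g u v) ∧
      (∀ u ∈ Aᶜ, d u = ∑ v ∈ Aᶜ, g u v) :=
    ⟨fun u => if u ∈ A then ∑ v ∈ A, g u v else ∑ v ∈ Aᶜ, g u v,
      fun u hu => by simp [hu], fun u hu => by simp [mem_compl.1 hu]⟩
  set S := ∑ u ∈ A, ∑ w ∈ Aᶜ, (1 - g u w) * (d u + d w) with hS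
  have hSle : 2 * S ≤ 2 * (q + j ^ 2 + σ * j) * k - j * PA + (j + σ) * PB := by
    by_cases hex : ∃ x ∈ A, ∃ y ∈ Aᶜ, 1 - g x y = 1
    · obtain ⟨x, hx, y, hy, hxy, hmax⟩ : ∃ x ∈ A, ∃ y ∈ Aᶜ, 1 - g x y = 1 ∧
          ∀ u ∈ A, ∀ w ∈ Aᶜ, 1 - g u w = 1 → d u + d w ≤ d x + d y := by
        obtain ⟨x, hx, y, hy, hxy⟩ := hex
        obtain ⟨⟨x', y'⟩, hm, hmax⟩ := exists_max_image
          {e ∈ A ×ˢ Aᶜ | 1 - g e.1 e.2 = 1} (fun e => d e.1 + d e.2)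
          ⟨(x, y), by simp only [mem_filter, mem_product]; exact ⟨⟨hx, hy⟩, hxy⟩⟩
        simp only [mem_filter, mem_product] at hm
        refine ⟨x', hm.1.1, y', hm.1.2, hm.2, fun u hu w hw huw => hmax (u, w) ?_⟩
        simp only [mem_filter, mem_product]
        exact ⟨⟨hu, hw⟩, huw⟩
      have hA : ∀ X ⊆ A, 2 * ∑ x ∈ X, d x ≤ PA + #X * (#X - 1) := fun X hX => by
        rw [sum_congr rfl fun u hu => hdA u (hX hu)]
        exact two_mul_sum_sum_le g h0 h1 hs hd hX
      have hB : ∀ X ⊆ Aᶜ, 2 * ∑ x ∈ X, d x ≤ PB + #X * (#X - 1) := fun X hX => by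
        rw [sum_congr rfl fun u hu => hdB u (hX hu)]
        exact two_mul_sum_sum_le g h0 h1 hs hd hX
      have hf : ∀ x y, 1 - g x y = 0 ∨ 1 - g x y = 1 := fun x y => by
        rcases hg x y with h | h <;> simp [h]
      have hf0 : ∀ x y, 0 ≤ 1 - g x y := fun x y => by linarith [h1 x y]
      have hmx1 : 1 ≤ ∑ w ∈ Aᶜ, (1 - g x w) :=
        hxy.symm.le.trans <| single_le_sum (f := fun w => 1 - g x w) (fun w _ => hf0 x w) hy
      have hmy1 : 1 ≤ ∑ u ∈ A, (1 - g u y) :=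
        hxy.symm.le.trans <| single_le_sum (f := fun u => 1 - g u y) (fun u _ => hf0 u y) hx
      obtain ⟨hz, hmain⟩ := sum_cross_le A Aᶜ (fun u w => 1 - g u w) d PA PB hf hA hB hx hy hxy
        hq rfl rfl
      have hSq : S ≤ q * (d x + d y) := by
        rw [hS, hq]
        simp only [sum_mul]
        refine sum_le_sum fun u hu => sum_le_sum fun w hw => ?_
        rcases hf u w with h | h
        · simp [h]
        · rw [h, one_mul, one_mul]; exact hmax u hu w hw h
      have hx2 := hA {x} (by simpa using hx)
      have hy2 := hB {y} (by simpa using hy)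
      simp only [sum_singleton, card_singleton, Nat.cast_one, sub_self, mul_zero, add_zero]
        at hx2 hy2
      rw [hP, ← hS] at hmain
      refine incidence_le k j σ s p q PA PB (d x) (d y) _ _ S hσ hj0 hsk hp hP hpk ?_ ?_ hmx1 hmy1 hz
        hx2 hy2 ?_ ?_ hSq (by linarith)
      · have := hlA x hx
        simp only [sum_sub_distrib, sum_const, nsmul_eq_mul, mul_one, hj, hdA x hx]
        linarith
      · have := hlB y hy
        simp only [sum_sub_distrib, sum_const, nsmul_eq_mul, mul_one, ha, hdB y hy, hs _ y]
        linarith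
      · rw [hdA x hx]; exact sum_nonneg fun _ _ => h0 _ _
      · rw [hdB y hy]; exact sum_nonneg fun _ _ => h0 _ _
    · have hf : ∀ u ∈ A, ∀ w ∈ Aᶜ, 1 - g u w = 0 := fun u hu w hw => by
        rcases hg u w with h | h
        · exact absurd ⟨u, hu, w, hw, by simp [h]⟩ hex
        · simp [h]
      have hS0 : S = 0 := sum_eq_zero fun u hu => sum_eq_zero fun w hw => by
        rw [hf u hu w hw, zero_mul]
      have hq0 : q = 0 := hq ▸ sum_eq_zero fun u hu => sum_eq_zero fun w hw => hf u hu w hw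
      subst hq0
      rw [hS0]
      have := incidence_le_of_no_missing k j σ s p PA PB hσ hj0 (by linarith) hsk (by linarith) hP hpk
        (sum_nonneg fun _ _ => sum_nonneg fun _ _ => h0 _ _)
      linarith
  have hT := crossing_triangles_le g hg hs A
  have hTA := cross_triangles_le g hg hs A Aᶜ
  have hTB := cross_triangles_le g hg hs Aᶜ A
  have hSsum : S = ∑ u ∈ A, ∑ w ∈ Aᶜ, (1 - g u w) * ∑ v ∈ A, g u v
      + ∑ u ∈ Aᶜ, ∑ w ∈ A, (1 - g u w) * ∑ v ∈ Aᶜ, g u v := by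
    rw [sum_comm (s := Aᶜ), ← sum_add_distrib]
    refine sum_congr rfl fun u hu => ?_
    rw [← sum_add_distrib]
    refine sum_congr rfl fun w hw => ?_
    rw [hdA u hu, hdB w hw, hs w u, mul_add]
  rw [hj, ← hPA] at hTA
  rw [ha, ← hPB] at hTB
  have hkP : k * (PA + PB) = k * (2 * (s + q + j ^ 2 + σ * j)) := by rw [hP, hp]
  linarith

theorem ordered_triangles_le {V : Type*} [Fintype V] [DecidableEq V] (G : SimpleGraph V)
    [DecidableRel G.Adj] :
    ∑ u, ∑ v, ∑ w, (if G.Adj u v then (1 : ℤ) else 0) * (if G.Adj v w then 1 else 0)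
      * (if G.Adj u w then 1 else 0) ≤ 6 * #(G.cliqueFinset 3) := by
  let T : Finset (V × V × V) := {e | G.Adj e.1 e.2.1 ∧ G.Adj e.2.1 e.2.2 ∧ G.Adj e.1 e.2.2}
  have hT : ∑ u, ∑ v, ∑ w, (if G.Adj u v then (1 : ℤ) else 0) * (if G.Adj v w then 1 else 0)
      * (if G.Adj u w then 1 else 0) = #T := by
    simp only [T, card_filter, Nat.cast_sum, Fintype.sum_prod_type]
    refine sum_congr rfl fun u _ => sum_congr rfl fun v _ => sum_congr rfl fun w _ => ?_
    by_cases h1 : G.Adj u v <;> by_cases h2 : G.Adj v w <;> by_cases h3 : G.Adj u w <;>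
      simp [h1, h2, h3]
  rw [hT]
  have := card_le_mul_card_image_of_maps_to (s := T) (t := G.cliqueFinset 3)
    (f := fun e => {e.1, e.2.1, e.2.2}) (fun e he => by
      simp only [T, mem_filter, mem_univ, true_and] at he
      rw [SimpleGraph.mem_cliqueFinset_iff, SimpleGraph.is3Clique_triple_iff]
      exact ⟨he.1, he.2.2, he.2.1⟩) 6 (fun t ht => by
      rw [SimpleGraph.mem_cliqueFinset_iff, SimpleGraph.is3Clique_iff] at ht
      obtain ⟨a, b, c, hab, hac, hbc, rfl⟩ := ht
      refine (card_le_card (t := {(a, b, c), (a, c, b), (b, a, c), (b, c, a), (c, a, b), (c, b, a)})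
        ?_).trans card_le_six
      rintro ⟨u, v, w⟩ he
      simp only [T, mem_filter, mem_univ, true_and] at he
      obtain ⟨⟨huv, hvw, huw⟩, he⟩ := he
      have hu : u ∈ ({a, b, c} : Finset V) := by simp [← he]
      have hv : v ∈ ({a, b, c} : Finset V) := by simp [← he]
      have hw : w ∈ ({a, b, c} : Finset V) := by simp [← he]
      have := huv.ne
      have := hvw.ne
      have := huw.ne
      simp only [mem_insert, mem_singleton, Prod.mk.injEq] at hu hv hw ⊢
      grind)
  exact_mod_cast this

/-- Lovász–Simonovits. A graph with `n` vertices and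
`⌊n/2⌋⌈n/2⌉ + s` edges, where `0 ≤ s < ⌊n/2⌋`, has at least `s·⌊n/2⌋` triangles. -/
theorem stmt9 {V : Type*} [Fintype V] [DecidableEq V] (G : SimpleGraph V)
    [DecidableRel G.Adj] (n s : ℕ) (hn : n = Fintype.card V)
    (hm : G.edgeFinset.card = (n / 2) * ((n + 1) / 2) + s) (hs : s < n / 2) :
    s * (n / 2) ≤ (G.cliqueFinset 3).card := by
  obtain rfl | hs0 := Nat.eq_zero_or_pos s
  · simp
  obtain ⟨k, hk⟩ : ∃ k, n / 2 = k := ⟨_, rfl⟩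
  obtain ⟨σ, hσ, hnk⟩ : ∃ σ, (σ = 0 ∨ σ = 1) ∧ n = 2 * k + σ := ⟨n % 2, by omega, by omega⟩
  have hk' : (n + 1) / 2 = k + σ := by omega
  rw [hk, hk'] at hm
  rw [hk] at hs ⊢
  have hle := ordered_triangles_le G
  have hlt := lt_ordered_triangles (fun u v => if G.Adj u v then (1 : ℤ) else 0)
    (fun u v => by by_cases h : G.Adj u v <;> simp [h]) (fun u v => by simp [G.adj_comm u v])
    (by simp) k s σ (by omega) (by omega) (by omega) (by rw [← hn, hnk]; push_cast; rfl) (by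
      have h := G.sum_degrees_eq_twice_card_edges
      rw [hm] at h
      have h' : ∀ u, ∑ v, (if G.Adj u v then (1 : ℤ) else 0) = G.degree u := fun u => by
        rw [sum_boole, ← G.card_neighborFinset_eq_degree, G.neighborFinset_eq_filter]
      simp only [h']
      exact_mod_cast h)
  have : (s * k : ℤ) ≤ #(G.cliqueFinset 3) := by linarith
  exact_mod_cast this
end

section
/- Let k ≥ 1 and let G be a graph with n ≥ 2k vertices and m edges where m ≥ n²/4 + (k-1)n/4 − k(k-1)/2. Then there exists a subset U of the vertices with |U| ≥ √n such that the induced subgraph G[U] has minimum degree at least ⌊|U|/2⌋ and number of edges at least |U|²/4 + (k-1)|U|/4 − k(k-1)/2. -/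
/-- The number of edges induced on `U` exceeds the number induced on `U.erase u` by at most the
degree of `u` in `U`. -/
theorem card_induced_edges_le_erase_add_degree {V : Type*} [Fintype V] [DecidableEq V]
    (G : SimpleGraph V) [DecidableRel G.Adj] (U : Finset V) (u : V) :
    (G.edgeFinset.filter (fun e => ∀ x ∈ e, x ∈ U)).card ≤
      (G.edgeFinset.filter (fun e => ∀ x ∈ e, x ∈ U.erase u)).card +
        (U.filter (fun w => G.Adj u w)).card := by
  have h : G.edgeFinset.filter (fun e => ∀ x ∈ e, x ∈ U) ⊆
      G.edgeFinset.filter (fun e => ∀ x ∈ e, x ∈ U.erase u) ∪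
        (U.filter (fun w => G.Adj u w)).image (fun w => s(u, w)) := by
    intro e
    induction e with
    | _ a b =>
      intro he
      simp only [Finset.mem_filter, SimpleGraph.mem_edgeFinset, SimpleGraph.mem_edgeSet,
        Sym2.mem_iff, forall_eq_or_imp, forall_eq, Finset.mem_union, Finset.mem_image,
        Finset.mem_erase] at he ⊢
      obtain ⟨hab, ha, hb⟩ := he
      by_cases hau : a = u
      · subst hau
        exact Or.inr ⟨b, ⟨hb, hab⟩, rfl⟩
      by_cases hbu : b = u
      · subst hbu
        exact Or.inr ⟨a, ⟨ha, hab.symm⟩, Sym2.eq_swap⟩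
      exact Or.inl ⟨hab, ⟨hau, ha⟩, hbu, hb⟩
  calc _ ≤ _ := Finset.card_le_card h
    _ ≤ _ := Finset.card_union_le _ _
    _ ≤ _ := Nat.add_le_add_left Finset.card_image_le _

theorem card_induced_edges_le_choose_two {V : Type*} [Fintype V] [DecidableEq V]
    (G : SimpleGraph V) [DecidableRel G.Adj] (U : Finset V) :
    (G.edgeFinset.filter (fun e => ∀ x ∈ e, x ∈ U)).card ≤ U.card.choose 2 := by
  rw [← Sym2.card_image_offDiag]
  apply Finset.card_le_card
  intro e
  induction e with
  | _ a b =>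
    intro he
    simp only [Finset.mem_filter, SimpleGraph.mem_edgeFinset, SimpleGraph.mem_edgeSet,
      Sym2.mem_iff, forall_eq_or_imp, forall_eq] at he
    obtain ⟨hab, ha, hb⟩ := he
    exact Finset.mem_image.2 ⟨(a, b), Finset.mem_offDiag.2 ⟨ha, hb, hab.ne⟩, rfl⟩


/-- If `G` has `n ≥ 2k` vertices and `m ≥ n²/4 + (k-1)n/4 − k(k-1)/2`
edges, then there is a set `U` of at least `√n` vertices such that the induced subgraph
`G[U]` has minimum degree at least `⌊|U|/2⌋` and at least
`|U|²/4 + (k-1)|U|/4 − k(k-1)/2` edges. -/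
theorem stmt16 {V : Type*} [Fintype V] [DecidableEq V] (G : SimpleGraph V)
    [DecidableRel G.Adj] (k n m : ℕ) (hk : 1 ≤ k)
    (hn : n = Fintype.card V) (hm : m = G.edgeFinset.card) (hnk : 2 * k ≤ n)
    (hbound : (n : ℝ) ^ 2 / 4 + ((k : ℝ) - 1) * n / 4 - (k : ℝ) * ((k : ℝ) - 1) / 2 ≤ m) :
    ∃ U : Finset V, Real.sqrt n ≤ U.card ∧
      (∀ u ∈ U, U.card / 2 ≤ (U.filter (fun w => G.Adj u w)).card) ∧
      (U.card : ℝ) ^ 2 / 4 + ((k : ℝ) - 1) * U.card / 4 - (k : ℝ) * ((k : ℝ) - 1) / 2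
        ≤ ((G.edgeFinset.filter (fun e => ∀ x ∈ e, x ∈ U)).card : ℝ) := by
  let e : Finset V → ℕ := fun U => (G.edgeFinset.filter (fun e => ∀ x ∈ e, x ∈ U)).card
  -- Each deletion gains at least `(k + 2) / 4` over the required number of edges.
  let P : Finset V → Prop := fun U => (U.card : ℝ) ^ 2 / 4 + ((k : ℝ) - 1) * U.card / 4
    - (k : ℝ) * ((k : ℝ) - 1) / 2 + ((n : ℝ) - U.card) * (k + 2) / 4 ≤ e U
  have huniv : P Finset.univ := by
    have he : e Finset.univ = m := by simp [e, hm]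
    simp only [P, he, Finset.card_univ, ← hn, sub_self, zero_mul, zero_div, add_zero]
    exact hbound
  obtain ⟨U, hU, hmin⟩ := exists_minimalFor_of_wellFoundedLT P Finset.card ⟨_, huniv⟩
  have hk1 : (1 : ℝ) ≤ k := by exact_mod_cast hk
  have hnk' : 2 * (k : ℝ) ≤ n := by exact_mod_cast hnk
  have hUn : (U.card : ℝ) ≤ n := by
    rw [hn]
    exact_mod_cast Finset.card_le_univ U
  have hU' : (U.card : ℝ) ^ 2 / 4 + ((k : ℝ) - 1) * U.card / 4
    - (k : ℝ) * ((k : ℝ) - 1) / 2 + ((n : ℝ) - U.card) * (k + 2) / 4 ≤ e U := hU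
  refine ⟨U, ?_, ?_, ?_⟩
  · have hchoose : (e U : ℝ) ≤ (U.card : ℝ) * (U.card - 1) / 2 := by
      rw [← Nat.cast_choose_two]
      exact_mod_cast card_induced_edges_le_choose_two G U
    have hsq : (U.card : ℝ) ≤ (U.card : ℝ) ^ 2 := by exact_mod_cast Nat.le_self_pow two_ne_zero _
    apply Real.sqrt_le_iff.2 ⟨by positivity, ?_⟩
    nlinarith [mul_nonneg (sub_nonneg.2 hk1) (sub_nonneg.2 hnk')]
  · intro u hu
    by_contra! hdeg
    have hcard : ((U.erase u).card : ℝ) = U.card - 1 := by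
      rw [Finset.card_erase_of_mem hu, Nat.cast_pred (Finset.card_pos.2 ⟨u, hu⟩)]
    have hlt := Finset.card_erase_lt_of_mem hu
    refine absurd (hmin (j := U.erase u) ?_ hlt.le) hlt.not_ge
    have hd : 2 * ((U.filter (fun w => G.Adj u w)).card : ℝ) + 2 ≤ U.card := by
      have : 2 * (U.filter (fun w => G.Adj u w)).card + 2 ≤ U.card := by omega
      exact_mod_cast this
    have he : (e U : ℝ) ≤ e (U.erase u) + (U.filter (fun w => G.Adj u w)).card := by
      exact_mod_cast card_induced_edges_le_erase_add_degree G U u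
    simp only [P, hcard]
    nlinarith
  · have : 0 ≤ ((n : ℝ) - U.card) * (k + 2) / 4 :=
      div_nonneg (mul_nonneg (sub_nonneg.2 hUn) (by positivity)) (by norm_num)
    change _ ≤ (e U : ℝ)
    linarith
end
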